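/- Assume (A1)–(A4) and λ>0. Then there exist positive constants h* ≤ h₀ and α ≤ T with α ∉ {t₁,…,t_K}, and nonnegative constants M₁, M₂, M₃, such that for every 0<h<h* the EPCA impulsive initial value problem has a unique solution (x_h,τ_h) on [0,α], and this solution satisfies: τ_h(t)>0 for t∈[0,α]; |x_h(t)|+τ_h(t)<M₁ for t∈(−∞,α]; |x_h(t)−x_h(t̄)| ≤ M₂|t−t̄| whenever t,t̄ lie in the same interval [t_k,t_{k+1})∩[0,α] (k=0,…,K) or in the same interval [t_{−k−1},t_{−k})∩[−M₁,0] (k∈ℕ₀); and |τ_h(t)−τ_h(t̄)| ≤ M₃|t−t̄| for all t,t̄∈[0,α]. -/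

import Mathlib

open Set Filter MeasureTheory

/-- The piecewise-constant argument `[t]_h = ⌊t/h⌋·h`. -/
noncomputable def flr (h t : ℝ) : ℝ := ⌊t / h⌋ * h

/-- `(x, τ)` is a solution of the EPCA impulsive initial value problem
(with stepsize `h`) on `(-∞, β]`: the initial conditions `x = φ`, `τ = λ`
hold on `(-∞,0]`, `τ` is continuous on `[0,β]` and satisfies the integral
equation with piecewise-constant arguments, `x` is right-continuous, has
left limits at the impulsive moments `tI 1 < ⋯ < tI K` where it jumps by
`Imp k` applied to the left limit, and `x` satisfies the integral equation
with piecewise-constant arguments on every subinterval of `[0,β]` containing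
no impulsive moment. -/
def IsEPCASol (n K : ℕ) (f : ℝ → (Fin n → ℝ) → (Fin n → ℝ) → (Fin n → ℝ))
    (g : ℝ → (Fin n → ℝ) → ℝ → ℝ) (Imp : ℕ → (Fin n → ℝ) → (Fin n → ℝ))
    (φ : ℝ → (Fin n → ℝ)) (lam : ℝ) (tI : ℕ → ℝ)
    (h β : ℝ) (x : ℝ → (Fin n → ℝ)) (τ : ℝ → ℝ) : Prop :=
  (∀ t ≤ (0 : ℝ), x t = φ t) ∧ (∀ t ≤ (0 : ℝ), τ t = lam) ∧
  ContinuousOn τ (Icc 0 β) ∧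
  (∀ t ∈ Icc (0 : ℝ) β,
    τ t = lam + ∫ s in (0 : ℝ)..t, g (flr h s) (x (flr h s)) (τ (flr h s))) ∧
  (∀ t ∈ Icc (0 : ℝ) β, Tendsto x (nhdsWithin t (Ici t)) (nhds (x t))) ∧
  (∀ k, 1 ≤ k → k ≤ K → tI k ≤ β →
    ∃ ξ, Tendsto x (nhdsWithin (tI k) (Iio (tI k))) (nhds ξ) ∧
      x (tI k) = ξ + Imp k ξ) ∧
  (∀ a b : ℝ, 0 ≤ a → a ≤ b → b ≤ β →
    (∀ k, 1 ≤ k → k ≤ K → tI k ∉ Ioc a b) →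
    x b = x a + ∫ s in a..b,
      f (flr h s) (x (flr h s)) (x (flr h s - flr h (τ (flr h s)))))

/-- `(x, τ)` is a solution of the impulsive initial value problem with
state-dependent adaptive delay on `(-∞, β]`. -/
def IsIIVPSol (n K : ℕ) (f : ℝ → (Fin n → ℝ) → (Fin n → ℝ) → (Fin n → ℝ))
    (g : ℝ → (Fin n → ℝ) → ℝ → ℝ) (Imp : ℕ → (Fin n → ℝ) → (Fin n → ℝ))
    (φ : ℝ → (Fin n → ℝ)) (lam : ℝ) (tI : ℕ → ℝ)
    (β : ℝ) (x : ℝ → (Fin n → ℝ)) (τ : ℝ → ℝ) : Prop :=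
  (∀ t ≤ (0 : ℝ), x t = φ t) ∧ (∀ t ≤ (0 : ℝ), τ t = lam) ∧
  ContinuousOn τ (Icc 0 β) ∧
  (∀ t ∈ Icc (0 : ℝ) β, τ t = lam + ∫ s in (0 : ℝ)..t, g s (x s) (τ s)) ∧
  (∀ t ∈ Icc (0 : ℝ) β, Tendsto x (nhdsWithin t (Ici t)) (nhds (x t))) ∧
  (∀ k, 1 ≤ k → k ≤ K → tI k ≤ β →
    ∃ ξ, Tendsto x (nhdsWithin (tI k) (Iio (tI k))) (nhds ξ) ∧
      x (tI k) = ξ + Imp k ξ) ∧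
  (∀ a b : ℝ, 0 ≤ a → a ≤ b → b ≤ β →
    (∀ k, 1 ≤ k → k ≤ K → tI k ∉ Ioc a b) →
    x b = x a + ∫ s in a..b, f s (x s) (x (s - τ s)))

/-- (A1): `f` is continuous on `[0,T]×ℝⁿ×ℝⁿ` and locally Lipschitz
continuous in its second and third arguments. -/
def AssumptionA1 (n : ℕ) (T : ℝ)
    (f : ℝ → (Fin n → ℝ) → (Fin n → ℝ) → (Fin n → ℝ)) : Prop :=
  ContinuousOn (fun p : ℝ × (Fin n → ℝ) × (Fin n → ℝ) => f p.1 p.2.1 p.2.2)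
    (Icc 0 T ×ˢ (univ : Set (Fin n → ℝ)) ×ˢ (univ : Set (Fin n → ℝ))) ∧
  ∀ M : ℝ, 0 < M → ∃ L : ℝ, 0 ≤ L ∧ ∀ t ∈ Icc (0 : ℝ) T,
    ∀ u ub v vb : Fin n → ℝ, ‖u‖ ≤ M → ‖ub‖ ≤ M → ‖v‖ ≤ M → ‖vb‖ ≤ M →
      ‖f t u v - f t ub vb‖ ≤ L * (‖u - ub‖ + ‖v - vb‖)

/-- (A2): `g` is continuous on `[0,T]×ℝⁿ×ℝ`, is positive when its last
argument vanishes, and is locally Lipschitz continuous in its second and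
third arguments. -/
def AssumptionA2 (n : ℕ) (T : ℝ) (g : ℝ → (Fin n → ℝ) → ℝ → ℝ) : Prop :=
  ContinuousOn (fun p : ℝ × (Fin n → ℝ) × ℝ => g p.1 p.2.1 p.2.2)
    (Icc 0 T ×ˢ (univ : Set (Fin n → ℝ)) ×ˢ (univ : Set ℝ)) ∧
  (∀ t ∈ Icc (0 : ℝ) T, ∀ u : Fin n → ℝ, 0 < g t u 0) ∧
  ∀ M : ℝ, 0 < M → ∃ L : ℝ, 0 ≤ L ∧ ∀ t ∈ Icc (0 : ℝ) T,
    ∀ u ub : Fin n → ℝ, ∀ w wb : ℝ, ‖u‖ ≤ M → ‖ub‖ ≤ M → |w| ≤ M → |wb| ≤ M →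
      |g t u w - g t ub wb| ≤ L * (‖u - ub‖ + |w - wb|)

/-- (A3): the impulse functions `I_k`, `k = 1,…,K`, are globally Lipschitz
continuous with a common Lipschitz constant. -/
def AssumptionA3 (n K : ℕ) (Imp : ℕ → (Fin n → ℝ) → (Fin n → ℝ)) : Prop :=
  ∃ L : ℝ, 0 ≤ L ∧ ∀ k, 1 ≤ k → k ≤ K → ∀ u ub : Fin n → ℝ,
    ‖Imp k u - Imp k ub‖ ≤ L * ‖u - ub‖

/-- (A4): the initial function `φ` is bounded on `(-∞,0]` and locally
piecewise Lipschitz continuous, with possible jump discontinuities only at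
the points of the strictly decreasing sequence `0 = tm 0 > tm 1 > ⋯ → -∞`,
where it is right-continuous. -/
def AssumptionA4 (n : ℕ) (φ : ℝ → (Fin n → ℝ)) (tm : ℕ → ℝ) : Prop :=
  tm 0 = 0 ∧ StrictAnti tm ∧ Tendsto tm atTop atBot ∧
  (∀ k : ℕ, Tendsto φ (nhdsWithin (tm k) (Ioi (tm k))) (nhds (φ (tm k)))) ∧
  (∃ N : ℝ, 0 ≤ N ∧ ∀ s ≤ (0 : ℝ), ‖φ s‖ ≤ N) ∧
  (∀ M : ℝ, 0 < M → ∃ L : ℝ, 0 ≤ L ∧ ∀ k : ℕ,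
    ∀ s ∈ Ico (tm (k + 1)) (tm k) ∩ Icc (-M) 0,
    ∀ sb ∈ Ico (tm (k + 1)) (tm k) ∩ Icc (-M) 0,
      ‖φ s - φ sb‖ ≤ L * |s - sb|)

section StepFunctions

variable {E : Type*} [NormedAddCommGroup E] [NormedSpace ℝ E]

theorem flr_eq_of_mem_Ico {h s : ℝ} (hh : 0 < h) {j : ℕ}
    (hs : s ∈ Ico (j * h) ((j + 1) * h)) : flr h s = j * h := by
  have hfloor : ⌊s / h⌋ = (j : ℤ) := by
    rw [Int.floor_eq_iff]
    constructor
    · rw [le_div_iff₀ hh]; exact_mod_cast hs.1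
    · rw [div_lt_iff₀ hh]; exact_mod_cast hs.2
  simp [flr, hfloor]

theorem flr_natCast_mul {h : ℝ} (hh : 0 < h) (j : ℕ) : flr h (j * h) = j * h :=
  flr_eq_of_mem_Ico hh ⟨le_rfl, by nlinarith⟩

theorem flr_nonneg {h s : ℝ} (hh : 0 < h) (hs : 0 ≤ s) : 0 ≤ flr h s :=
  mul_nonneg (by exact_mod_cast Int.floor_nonneg.2 (div_nonneg hs hh.le)) hh.le

theorem flr_le {h : ℝ} (hh : 0 < h) (s : ℝ) : flr h s ≤ s :=
  (le_div_iff₀ hh).1 (Int.floor_le _)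

theorem exists_mem_Ico_mesh {h t : ℝ} (hh : 0 < h) (ht : 0 ≤ t) :
    ∃ j : ℕ, t ∈ Ico (j * h) ((j + 1) * h) :=
  ⟨⌊t / h⌋₊, (le_div_iff₀ hh).1 (Nat.floor_le (div_nonneg ht hh.le)),
    (div_lt_iff₀ hh).1 (Nat.lt_floor_add_one _)⟩

theorem comp_flr_eqOn {X : Type*} {h a b : ℝ} (hh : 0 < h) (G : ℝ → X) {j : ℕ}
    (ha : j * h ≤ a) (hab : a ≤ b) (hb : b ≤ (j + 1) * h) :
    EqOn (fun s => G (flr h s)) (fun _ => G (j * h)) (uIoo a b) := by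
  intro s hs
  rw [uIoo_of_le hab] at hs
  simp only
  rw [flr_eq_of_mem_Ico hh ⟨ha.trans hs.1.le, hs.2.trans_le hb⟩]

theorem integral_comp_flr [CompleteSpace E] {h a b : ℝ} (hh : 0 < h) (G : ℝ → E) {j : ℕ}
    (ha : j * h ≤ a) (hab : a ≤ b) (hb : b ≤ (j + 1) * h) :
    ∫ s in a..b, G (flr h s) = (b - a) • G (j * h) := by
  rw [intervalIntegral.integral_congr_uIoo (comp_flr_eqOn hh G ha hab hb),
    intervalIntegral.integral_const]

theorem intervalIntegrable_comp_flr {X : Type*} [NormedAddCommGroup X] {h a b : ℝ}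
    (hh : 0 < h) (G : ℝ → X)
    (ha : 0 ≤ a) (hb : 0 ≤ b) :
    IntervalIntegrable (fun s => G (flr h s)) volume a b := by
  have key : ∀ c : ℝ, 0 ≤ c → IntervalIntegrable (fun s => G (flr h s)) volume 0 c := by
    intro c hc
    obtain ⟨j, hj⟩ := exists_mem_Ico_mesh hh hc
    have hmesh := IntervalIntegrable.trans_iterate (f := fun s => G (flr h s)) (μ := volume)
      (a := fun i : ℕ => (i : ℝ) * h) (n := j + 1) fun i _ =>
        (intervalIntegrable_const (c := G (i * h))).congr_uIoo
          (comp_flr_eqOn hh G le_rfl (by push_cast; nlinarith) (by push_cast; rfl)).symm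
    refine hmesh.mono_set ?_
    have hle : (0 : ℝ) ≤ (j + 1) * h := by positivity
    simp only [Nat.cast_zero, zero_mul, Nat.cast_add, Nat.cast_one]
    rw [uIcc_of_le hc, uIcc_of_le hle]
    exact Icc_subset_Icc le_rfl hj.2.le
  exact (key a ha).symm.trans (key b hb)

/-- A causal functional `Φ` generates a polygonal path with history `x₀`. -/
theorem exists_polygonal {h : ℝ} (hh : 0 < h) (x₀ : ℝ → E) (Φ : ℕ → (ℝ → E) → E)
    (hΦ : ∀ (j : ℕ) (x y : ℝ → E), (∀ t ≤ j * h, x t = y t) → Φ j x = Φ j y) :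
    ∃ x : ℝ → E, (∀ t ≤ 0, x t = x₀ t) ∧
      ∀ j : ℕ, ∀ t ∈ Icc (j * h) ((j + 1) * h), x t = x (j * h) + (t - j * h) • Φ j x := by
  let P : ℕ → ℝ → E := fun j => Nat.rec x₀
    (fun j y t => if t ≤ j * h then y t else y (j * h) + (t - j * h) • Φ j y) j
  have hP (j : ℕ) (t : ℝ) : P (j + 1) t =
      if t ≤ j * h then P j t else P j (j * h) + (t - j * h) • Φ j (P j) := rfl
  have hstable (i : ℕ) (t : ℝ) (ht : t ≤ i * h) (j : ℕ) (hij : i ≤ j) : P j t = P i t := by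
    induction j, hij using Nat.le_induction with
    | base => rfl
    | succ j hij ih =>
      have hle : (i : ℝ) * h ≤ j * h := by gcongr
      rw [hP, if_pos (ht.trans hle), ih]
  let x : ℝ → E := fun t => P ⌈t / h⌉₊ t
  have hx (j : ℕ) (t : ℝ) (ht : t ≤ j * h) : x t = P j t :=
    (hstable _ t ((div_le_iff₀ hh).1 (Nat.le_ceil _)) j
      (Nat.ceil_le.2 ((div_le_iff₀ hh).2 ht))).symm
  refine ⟨x, fun t ht => hx 0 t (by simpa using ht), fun j t ht => ?_⟩
  rcases ht.1.eq_or_lt with rfl | hlt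
  · simp
  · rw [hx (j + 1) t (by exact_mod_cast ht.2), hP, if_neg hlt.not_ge, hx j _ le_rfl,
      hΦ j x (P j) fun s hs => hx j s hs]

theorem polygonal_eq_add_integral [CompleteSpace E] {h : ℝ} (hh : 0 < h) {y G : ℝ → E}
    (hy : ∀ j : ℕ, ∀ t ∈ Icc (j * h) ((j + 1) * h), y t = y (j * h) + (t - j * h) • G (j * h))
    {a b : ℝ} (ha : 0 ≤ a) (hb : 0 ≤ b) : y b = y a + ∫ s in a..b, G (flr h s) := by
  have hmesh (j : ℕ) : y (j * h) = y 0 + ∫ s in (0 : ℝ)..(j * h), G (flr h s) := by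
    induction j with
    | zero => simp
    | succ j ih =>
      have hle : (j : ℝ) * h ≤ (j + 1) * h := by nlinarith
      push_cast
      rw [hy j _ ⟨hle, le_rfl⟩, ← intervalIntegral.integral_add_adjacent_intervals
        (intervalIntegrable_comp_flr hh G le_rfl (by positivity : (0 : ℝ) ≤ j * h))
        (intervalIntegrable_comp_flr hh G (by positivity) (by positivity)),
        integral_comp_flr hh G le_rfl hle le_rfl, ih, add_assoc]
  have key (c : ℝ) (hc : 0 ≤ c) : y c = y 0 + ∫ s in (0 : ℝ)..c, G (flr h s) := by
    obtain ⟨j, hj⟩ := exists_mem_Ico_mesh hh hc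
    rw [hy j c (Ico_subset_Icc_self hj), ← intervalIntegral.integral_add_adjacent_intervals
      (intervalIntegrable_comp_flr hh G le_rfl (by positivity : (0 : ℝ) ≤ j * h))
      (intervalIntegrable_comp_flr hh G (by positivity) hc),
      integral_comp_flr hh G le_rfl hj.1 hj.2.le, hmesh j, add_assoc]
  rw [key b hb, key a ha, add_assoc, intervalIntegral.integral_add_adjacent_intervals
    (intervalIntegrable_comp_flr hh G le_rfl ha) (intervalIntegrable_comp_flr hh G ha hb)]

theorem polygonal_tendsto_right {h : ℝ} (hh : 0 < h) {y G : ℝ → E}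
    (hy : ∀ j : ℕ, ∀ t ∈ Icc (j * h) ((j + 1) * h), y t = y (j * h) + (t - j * h) • G (j * h))
    {t : ℝ} (ht : 0 ≤ t) : Tendsto y (nhdsWithin t (Ici t)) (nhds (y t)) := by
  obtain ⟨j, hj⟩ := exists_mem_Ico_mesh hh ht
  have hcont : ContinuousWithinAt (fun s => y (j * h) + (s - j * h) • G (j * h)) (Ici t) t := by
    fun_prop
  refine ContinuousWithinAt.congr_of_eventuallyEq hcont ?_ (hy j t (Ico_subset_Icc_self hj))
  filter_upwards [Ico_mem_nhdsGE hj.2] with s hs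
  exact hy j s ⟨hj.1.trans hs.1, hs.2.le⟩

end StepFunctions

/-- Before the first impulsive moment, a solution with positive delay is the only solution. -/
theorem IsEPCASol.eq_of_pos {n K : ℕ} {f : ℝ → (Fin n → ℝ) → (Fin n → ℝ) → (Fin n → ℝ)}
    {g : ℝ → (Fin n → ℝ) → ℝ → ℝ} {Imp : ℕ → (Fin n → ℝ) → (Fin n → ℝ)}
    {φ : ℝ → (Fin n → ℝ)} {lam : ℝ} {tI : ℕ → ℝ} {h β : ℝ} {x y : ℝ → (Fin n → ℝ)} {τ σ : ℝ → ℝ}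
    (hh : 0 < h) (hβ : ∀ k, 1 ≤ k → k ≤ K → β < tI k)
    (hx : IsEPCASol n K f g Imp φ lam tI h β x τ) (hτ : ∀ t ∈ Icc (0 : ℝ) β, 0 < τ t)
    (hy : IsEPCASol n K f g Imp φ lam tI h β y σ) {t : ℝ} (ht : t ≤ β) :
    y t = x t ∧ σ t = τ t := by
  have cell {x : ℝ → (Fin n → ℝ)} {τ : ℝ → ℝ} (hx : IsEPCASol n K f g Imp φ lam tI h β x τ)
      (j : ℕ) (t : ℝ) (ht : t ∈ Icc (j * h) ((j + 1) * h)) (htβ : t ≤ β) :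
      x t = x (j * h) + (t - j * h) • f (j * h) (x (j * h))
        (x (j * h - flr h (τ (j * h)))) ∧
      τ t = τ (j * h) + (t - j * h) • g (j * h) (x (j * h)) (τ (j * h)) := by
    obtain ⟨-, -, -, hτint, -, -, hxint⟩ := hx
    have hj : (0 : ℝ) ≤ j * h := by positivity
    constructor
    · rw [hxint (j * h) t hj ht.1 htβ fun k h1 hK hk => (hk.2.trans htβ).not_gt (hβ k h1 hK)]
      congr 1
      exact integral_comp_flr hh (fun u => f u (x u) (x (u - flr h (τ u)))) le_rfl ht.1 ht.2
    · rw [hτint t ⟨hj.trans ht.1, htβ⟩, hτint (j * h) ⟨hj, ht.1.trans htβ⟩, add_assoc]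
      congr 1
      rw [← hτint (j * h) ⟨hj, ht.1.trans htβ⟩]
      rw [← intervalIntegral.integral_add_adjacent_intervals
        (intervalIntegrable_comp_flr hh (fun u => g u (x u) (τ u)) le_rfl hj)
        (intervalIntegrable_comp_flr hh (fun u => g u (x u) (τ u)) hj (hj.trans ht.1))]
      congr 1
      exact integral_comp_flr hh (fun u => g u (x u) (τ u)) le_rfl ht.1 ht.2
  have mesh (j : ℕ) : ∀ t ≤ (j : ℝ) * h, t ≤ β → y t = x t ∧ σ t = τ t := by
    induction j with
    | zero =>
      intro t ht _
      have ht0 : t ≤ 0 := by simpa using ht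
      exact ⟨(hy.1 t ht0).trans (hx.1 t ht0).symm, (hy.2.1 t ht0).trans (hx.2.1 t ht0).symm⟩
    | succ j ih =>
      intro t ht htβ
      rcases le_total t (j * h) with hle | hle
      · exact ih t hle htβ
      · have hj : (0 : ℝ) ≤ j * h := by positivity
        have htj : t ∈ Icc ((j : ℝ) * h) ((j + 1) * h) := ⟨hle, by exact_mod_cast ht⟩
        have hjβ := hle.trans htβ
        obtain ⟨hxj, hτj⟩ := ih (j * h) le_rfl hjβ
        have hdelay : (j : ℝ) * h - flr h (τ (j * h)) ≤ j * h :=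
          sub_le_self _ (flr_nonneg hh (hτ _ ⟨hj, hjβ⟩).le)
        obtain ⟨hxd, -⟩ := ih _ hdelay (hdelay.trans hjβ)
        rw [(cell hx j t htj htβ).1, (cell hx j t htj htβ).2, (cell hy j t htj htβ).1,
          (cell hy j t htj htβ).2, hxj, hτj, hxd]
        exact ⟨rfl, rfl⟩
  exact mesh ⌈t / h⌉₊ t ((div_le_iff₀ hh).1 (Nat.le_ceil _)) ht

/-- A priori bounds `F`, `G` for `f`, `g` on the relevant ball give a solution on `[0, α]`
for `α` small and before the first impulsive moment. -/
theorem exists_isEPCASol {n K : ℕ} {f : ℝ → (Fin n → ℝ) → (Fin n → ℝ) → (Fin n → ℝ)}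
    {g : ℝ → (Fin n → ℝ) → ℝ → ℝ} (Imp : ℕ → (Fin n → ℝ) → (Fin n → ℝ))
    {φ : ℝ → (Fin n → ℝ)} {lam : ℝ} {tI : ℕ → ℝ} {h α N F G : ℝ}
    (hlam : 0 < lam) (hh : 0 < h) (hα : ∀ k, 1 ≤ k → k ≤ K → α < tI k)
    (hφ : ∀ s ≤ (0 : ℝ), ‖φ s‖ ≤ N) (hF0 : 0 ≤ F) (hG0 : 0 ≤ G)
    (hF : ∀ t ∈ Icc (0 : ℝ) α, ∀ u v, ‖u‖ ≤ N + 1 → ‖v‖ ≤ N + 1 → ‖f t u v‖ ≤ F)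
    (hG : ∀ t ∈ Icc (0 : ℝ) α, ∀ u w, ‖u‖ ≤ N + 1 → |w| ≤ 2 * lam → |g t u w| ≤ G)
    (hFα : F * α ≤ 1) (hGα : G * α ≤ lam / 2) :
    ∃ x τ, IsEPCASol n K f g Imp φ lam tI h α x τ ∧
      (∀ t ∈ Icc (0 : ℝ) α, 0 < τ t) ∧
      (∀ t ≤ α, ‖x t‖ ≤ N + 1 ∧ τ t ≤ 2 * lam) ∧
      (∀ t ∈ Icc (0 : ℝ) α, ∀ s ∈ Icc (0 : ℝ) α, ‖x t - x s‖ ≤ F * |t - s|) ∧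
      (∀ t ∈ Icc (0 : ℝ) α, ∀ s ∈ Icc (0 : ℝ) α, |τ t - τ s| ≤ G * |t - s|) := by
  -- Clipping the delayed argument makes the recursion causal before positivity is known.
  obtain ⟨z, hz0, hz⟩ := exists_polygonal hh (fun t => (φ t, lam))
    (fun j z => (f (j * h) (z (j * h)).1 (z (min (j * h) (j * h - flr h (z (j * h)).2))).1,
      g (j * h) (z (j * h)).1 (z (j * h)).2)) (by
    intro j x y hxy
    rw [hxy _ le_rfl, hxy _ (min_le_left _ _)])
  set x : ℝ → (Fin n → ℝ) := fun t => (z t).1 with hxdef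
  set τ : ℝ → ℝ := fun t => (z t).2 with hτdef
  set A : ℝ → (Fin n → ℝ) := fun u => f u (x u) (x (min u (u - flr h (τ u)))) with hA
  set B : ℝ → ℝ := fun u => g u (x u) (τ u) with hB
  have hx0 (t : ℝ) (ht : t ≤ 0) : x t = φ t := congrArg Prod.fst (hz0 t ht)
  have hτ0 (t : ℝ) (ht : t ≤ 0) : τ t = lam := congrArg Prod.snd (hz0 t ht)
  have hx (j : ℕ) (t : ℝ) (ht : t ∈ Icc (j * h) ((j + 1) * h)) :
      x t = x (j * h) + (t - j * h) • A (j * h) := congrArg Prod.fst (hz j t ht)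
  have hτ (j : ℕ) (t : ℝ) (ht : t ∈ Icc (j * h) ((j + 1) * h)) :
      τ t = τ (j * h) + (t - j * h) • B (j * h) := congrArg Prod.snd (hz j t ht)
  have hφ0 := hφ 0 le_rfl
  have hxnorm {t : ℝ} (htα : t ≤ α) (hb : ‖x t - φ 0‖ ≤ F * t) : ‖x t‖ ≤ N + 1 := by
    have h1 := norm_le_norm_add_norm_sub' (x t) (φ 0)
    have : F * t ≤ F * α := by gcongr
    linarith
  have hτabs {t : ℝ} (htα : t ≤ α) (hb : |τ t - lam| ≤ G * t) :
      lam / 2 ≤ τ t ∧ τ t ≤ 2 * lam := by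
    have : G * t ≤ G * α := by gcongr
    obtain ⟨h1, h2⟩ := abs_le.1 hb
    constructor <;> linarith
  have mesh (j : ℕ) : ∀ t ∈ Icc (0 : ℝ) (j * h), t ≤ α →
      ‖x t - φ 0‖ ≤ F * t ∧ |τ t - lam| ≤ G * t := by
    induction j with
    | zero =>
      intro t ht _
      have : t = 0 := le_antisymm (by simpa using ht.2) ht.1
      subst this
      simp [hx0 0 le_rfl, hτ0 0 le_rfl]
    | succ j ih =>
      intro t ht htα
      rcases le_total t (j * h) with hle | hle
      · exact ih t ⟨ht.1, hle⟩ htα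
      · have hj : (0 : ℝ) ≤ j * h := by positivity
        have hjα := hle.trans htα
        have htj : t ∈ Icc ((j : ℝ) * h) ((j + 1) * h) := ⟨hle, by exact_mod_cast ht.2⟩
        obtain ⟨bx, bτ⟩ := ih (j * h) ⟨hj, le_rfl⟩ hjα
        have hxj := hxnorm hjα bx
        obtain ⟨hτj, hτj'⟩ := hτabs hjα bτ
        have hxd (s : ℝ) (hs : s ≤ j * h) : ‖x s‖ ≤ N + 1 := by
          rcases le_total s 0 with hs0 | hs0
          · rw [hx0 s hs0]; linarith [hφ s hs0]
          · exact hxnorm (hs.trans hjα) (ih s ⟨hs0, hs⟩ (hs.trans hjα)).1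
        have hAj : ‖A (j * h)‖ ≤ F :=
          hF _ ⟨hj, hjα⟩ _ _ hxj (hxd _ (min_le_left _ _))
        have hBj : ‖B (j * h)‖ ≤ G :=
          hG _ ⟨hj, hjα⟩ _ _ hxj (abs_le.2 ⟨by linarith, hτj'⟩)
        have hsub : 0 ≤ t - j * h := sub_nonneg.2 hle
        constructor
        · calc ‖x t - φ 0‖ = ‖(x (j * h) - φ 0) + (t - j * h) • A (j * h)‖ := by
                rw [hx j t htj]; congr 1; abel
            _ ≤ ‖x (j * h) - φ 0‖ + ‖(t - j * h) • A (j * h)‖ := norm_add_le _ _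
            _ ≤ F * (j * h) + (t - j * h) * F := by
                rw [norm_smul, Real.norm_of_nonneg hsub]; gcongr
            _ = F * t := by ring
        · calc |τ t - lam| = ‖(τ (j * h) - lam) + (t - j * h) • B (j * h)‖ := by
                rw [hτ j t htj, Real.norm_eq_abs]; congr 1; abel
            _ ≤ ‖τ (j * h) - lam‖ + ‖(t - j * h) • B (j * h)‖ := norm_add_le _ _
            _ ≤ G * (j * h) + (t - j * h) * G := by
                rw [norm_smul, Real.norm_of_nonneg hsub]; gcongr; exact bτ
            _ = G * t := by ring
  have bound (t : ℝ) (ht : t ∈ Icc 0 α) :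
      ‖x t‖ ≤ N + 1 ∧ lam / 2 ≤ τ t ∧ τ t ≤ 2 * lam := by
    have hb := mesh ⌈t / h⌉₊ t ⟨ht.1, (div_le_iff₀ hh).1 (Nat.le_ceil _)⟩ ht.2
    exact ⟨hxnorm ht.2 hb.1, hτabs ht.2 hb.2⟩
  have xbound (t : ℝ) (ht : t ≤ α) : ‖x t‖ ≤ N + 1 ∧ τ t ≤ 2 * lam := by
    rcases le_total t 0 with ht0 | ht0
    · rw [hx0 t ht0, hτ0 t ht0]
      constructor <;> linarith [hφ t ht0]
    · exact ⟨(bound t ⟨ht0, ht⟩).1, (bound t ⟨ht0, ht⟩).2.2⟩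
  have hflr (s : ℝ) (hs : s ∈ Icc 0 α) : flr h s ∈ Icc 0 α :=
    ⟨flr_nonneg hh hs.1, (flr_le hh s).trans hs.2⟩
  have hAbound (s : ℝ) (hs : s ∈ Icc 0 α) : ‖A s‖ ≤ F :=
    hF _ hs _ _ (bound _ hs).1 (xbound _ ((min_le_left _ _).trans hs.2)).1
  have hBbound (s : ℝ) (hs : s ∈ Icc 0 α) : ‖B s‖ ≤ G :=
    hG _ hs _ _ (bound _ hs).1 (abs_le.2 ⟨by linarith [(bound _ hs).2.1], (bound _ hs).2.2⟩)
  have hsub {a b : ℝ} (ha : a ∈ Icc 0 α) (hb : b ∈ Icc 0 α) {s : ℝ} (hs : s ∈ uIoc a b) :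
      s ∈ Icc 0 α := (convex_Icc (0 : ℝ) α).ordConnected.uIcc_subset ha hb (uIoc_subset_uIcc hs)
  have xlip : ∀ t ∈ Icc (0 : ℝ) α, ∀ s ∈ Icc (0 : ℝ) α, ‖x t - x s‖ ≤ F * |t - s| := by
    intro t ht s hs
    rw [polygonal_eq_add_integral hh hx hs.1 ht.1, add_sub_cancel_left]
    exact intervalIntegral.norm_integral_le_of_norm_le_const fun r hr =>
      hAbound _ (hflr r (hsub hs ht hr))
  have τlip : ∀ t ∈ Icc (0 : ℝ) α, ∀ s ∈ Icc (0 : ℝ) α, |τ t - τ s| ≤ G * |t - s| := by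
    intro t ht s hs
    rw [polygonal_eq_add_integral hh hτ hs.1 ht.1, add_sub_cancel_left]
    exact intervalIntegral.norm_integral_le_of_norm_le_const fun r hr =>
      hBbound _ (hflr r (hsub hs ht hr))
  refine ⟨x, τ, ⟨hx0, hτ0, ?_, ?_, ?_, ?_, ?_⟩, fun t ht => by linarith [(bound t ht).2.1],
    xbound, xlip, τlip⟩
  · exact (LipschitzOnWith.of_dist_le_mul (K := ⟨G, hG0⟩)
      fun t ht s hs => τlip t ht s hs).continuousOn
  · intro t ht
    rw [← hτ0 0 le_rfl]
    exact polygonal_eq_add_integral hh hτ le_rfl ht.1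
  · exact fun t ht => polygonal_tendsto_right hh hx ht.1
  · exact fun k h1 hK hk => absurd hk (hα k h1 hK).not_ge
  · intro a b ha hab hb _
    rw [polygonal_eq_add_integral hh hx ha (ha.trans hab)]
    congr 1
    refine intervalIntegral.integral_congr fun s hs => ?_
    rw [uIcc_of_le hab] at hs
    have hs' := hflr s ⟨ha.trans hs.1, hs.2.trans hb⟩
    have hpos := (bound _ hs').2.1
    simp only [hA]
    rw [min_eq_right (sub_le_self _ (flr_nonneg hh (by linarith)))]

theorem exists_bound_of_continuousOn_ball {E F G : Type*}
    [NormedAddCommGroup E] [ProperSpace E] [NormedAddCommGroup F] [ProperSpace F]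
    [NormedAddCommGroup G] {T : ℝ} {f : ℝ → E → F → G}
    (hf : ContinuousOn (fun p : ℝ × E × F => f p.1 p.2.1 p.2.2)
      (Icc 0 T ×ˢ (univ : Set E) ×ˢ (univ : Set F))) (R S : ℝ) :
    ∃ C, 0 ≤ C ∧ ∀ t ∈ Icc (0 : ℝ) T, ∀ u v, ‖u‖ ≤ R → ‖v‖ ≤ S → ‖f t u v‖ ≤ C := by
  have hcomp : IsCompact (Icc (0 : ℝ) T ×ˢ Metric.closedBall (0 : E) R ×ˢ
      Metric.closedBall (0 : F) S) :=
    isCompact_Icc.prod ((isCompact_closedBall _ _).prod (isCompact_closedBall _ _))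
  obtain ⟨C, hC⟩ := hcomp.exists_bound_of_continuousOn
    (hf.mono (prod_mono_right (prod_mono (subset_univ _) (subset_univ _))))
  refine ⟨max C 0, le_max_right _ _, fun t ht u v hu hv => (hC (t, u, v) ?_).trans (le_max_left _ _)⟩
  exact ⟨ht, mem_closedBall_zero_iff.2 hu, mem_closedBall_zero_iff.2 hv⟩

/-- Lemma 3.2: under (A1)–(A4) and `λ > 0` there exist `0 < h* ≤ h₀` and
`0 < α ≤ T` with `α` not an impulsive moment, and constants `M₁, M₂, M₃ ≥ 0`,
such that for every `0 < h < h*` the EPCA impulsive initial value problem has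
a unique solution `(x_h, τ_h)` on `[0,α]`, and this solution satisfies
`τ_h > 0` on `[0,α]`, `‖x_h(t)‖ + τ_h(t) < M₁` on `(-∞,α]`, the Lipschitz
estimate with constant `M₂` on the intervals `[tI k, tI (k+1)) ∩ [0,α]` and
`[tm (k+1), tm k) ∩ [-M₁,0]`, and the Lipschitz estimate with constant `M₃`
for `τ_h` on `[0,α]`. -/
theorem stmt3 (n K : ℕ) (T lam : ℝ) (hT : 0 < T) (hlam : 0 < lam)
    (f : ℝ → (Fin n → ℝ) → (Fin n → ℝ) → (Fin n → ℝ))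
    (g : ℝ → (Fin n → ℝ) → ℝ → ℝ) (Imp : ℕ → (Fin n → ℝ) → (Fin n → ℝ))
    (φ : ℝ → (Fin n → ℝ)) (tm : ℕ → ℝ)
    (hA1 : AssumptionA1 n T f) (hA2 : AssumptionA2 n T g)
    (hA3 : AssumptionA3 n K Imp) (hA4 : AssumptionA4 n φ tm)
    (tI : ℕ → ℝ) (htI0 : tI 0 = 0) (htIK : tI (K + 1) = T)
    (htImono : ∀ k ≤ K, tI k < tI (k + 1))
    (h0 : ℝ) (hh0min : ∀ k ≤ K, h0 ≤ tI (k + 1) - tI k)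
    (hh0mem : ∃ k ≤ K, h0 = tI (k + 1) - tI k) :
    ∃ hstar α : ℝ, 0 < hstar ∧ hstar ≤ h0 ∧ 0 < α ∧ α ≤ T ∧
      (∀ k, 1 ≤ k → k ≤ K → α ≠ tI k) ∧
      ∃ M1 M2 M3 : ℝ, 0 ≤ M1 ∧ 0 ≤ M2 ∧ 0 ≤ M3 ∧
        ∀ h : ℝ, 0 < h → h < hstar →
          (∃ x τ, IsEPCASol n K f g Imp φ lam tI h α x τ ∧
            (∀ t ∈ Icc (0 : ℝ) α, 0 < τ t) ∧
            (∀ t ≤ α, ‖x t‖ + τ t < M1) ∧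
            (∀ k ≤ K, ∀ t ∈ Ico (tI k) (tI (k + 1)) ∩ Icc 0 α,
              ∀ tb ∈ Ico (tI k) (tI (k + 1)) ∩ Icc 0 α,
                ‖x t - x tb‖ ≤ M2 * |t - tb|) ∧
            (∀ k : ℕ, ∀ t ∈ Ico (tm (k + 1)) (tm k) ∩ Icc (-M1) 0,
              ∀ tb ∈ Ico (tm (k + 1)) (tm k) ∩ Icc (-M1) 0,
                ‖x t - x tb‖ ≤ M2 * |t - tb|) ∧
            (∀ t ∈ Icc (0 : ℝ) α, ∀ tb ∈ Icc (0 : ℝ) α,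
                |τ t - τ tb| ≤ M3 * |t - tb|)) ∧
          (∀ x1 τ1 x2 τ2,
            IsEPCASol n K f g Imp φ lam tI h α x1 τ1 →
            IsEPCASol n K f g Imp φ lam tI h α x2 τ2 →
            ∀ t ≤ α, x1 t = x2 t ∧ τ1 t = τ2 t) := by
  obtain ⟨-, -, -, -, ⟨N, hN0, hN⟩, hφlip⟩ := hA4
  obtain ⟨F, hF0, hF⟩ := exists_bound_of_continuousOn_ball hA1.1 (N + 1) (N + 1)
  obtain ⟨G, hG0, hG⟩ := exists_bound_of_continuousOn_ball hA2.1 (N + 1) (2 * lam)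
  obtain ⟨L, hL0, hL⟩ := hφlip (N + 2 + 2 * lam) (by linarith)
  have htI : ∀ k, 1 ≤ k → k ≤ K + 1 → tI 1 ≤ tI k := by
    intro k hk
    induction k, hk using Nat.le_induction with
    | base => exact fun _ => le_rfl
    | succ k _ ih => exact fun hkK => (ih (by omega)).trans (htImono k (by omega)).le
  have htI1 : 0 < tI 1 := htI0 ▸ htImono 0 (Nat.zero_le _)
  have htI1T : tI 1 ≤ T := htIK ▸ htI (K + 1) (by omega) le_rfl
  have hh0 : 0 < h0 := by
    obtain ⟨k, hk, rfl⟩ := hh0mem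
    exact sub_pos.2 (htImono k hk)
  obtain ⟨α, hα0, hα1, hαF, hαG⟩ : ∃ α : ℝ, 0 < α ∧ α < tI 1 ∧ F * α ≤ 1 ∧
      G * α ≤ lam / 2 := by
    refine ⟨min (tI 1 / 2) (min (1 / (F + 1)) (lam / 2 / (G + 1))), by positivity,
      (min_le_left _ _).trans_lt (by linarith), ?_, ?_⟩
    · calc F * _ ≤ (F + 1) * (1 / (F + 1)) := by
            gcongr
            · linarith
            · exact (min_le_right _ _).trans (min_le_left _ _)
        _ = 1 := by field_simp
    · calc G * _ ≤ (G + 1) * (lam / 2 / (G + 1)) := by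
            gcongr
            · linarith
            · exact (min_le_right _ _).trans (min_le_right _ _)
        _ = lam / 2 := by field_simp
  have hαT : α ≤ T := hα1.le.trans htI1T
  have hαI (k : ℕ) (h1 : 1 ≤ k) (hK : k ≤ K) : α < tI k := hα1.trans_le (htI k h1 (by omega))
  refine ⟨h0, α, hh0, le_rfl, hα0, hαT, fun k h1 hK => (hαI k h1 hK).ne,
    N + 2 + 2 * lam, F + L, G, by linarith, by linarith, hG0, fun h hh _ => ?_⟩
  obtain ⟨x, τ, hsol, hpos, hbd, hxlip, hτlip⟩ := exists_isEPCASol Imp hlam hh hαI hN hF0 hG0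
    (fun t ht => hF t ⟨ht.1, ht.2.trans hαT⟩) (fun t ht => hG t ⟨ht.1, ht.2.trans hαT⟩) hαF hαG
  refine ⟨⟨x, τ, hsol, hpos, fun t ht => by linarith [(hbd t ht).1, (hbd t ht).2], ?_, ?_, hτlip⟩, ?_⟩
  · intro k _ t ht s hs
    refine (hxlip t ht.2 s hs.2).trans ?_
    gcongr
    linarith
  · intro k t ht s hs
    rw [hsol.1 t ht.2.2, hsol.1 s hs.2.2]
    refine (hL k t ht s hs).trans ?_
    gcongr
    linarith
  · intro x1 τ1 x2 τ2 h1 h2 t ht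
    obtain ⟨hx1, hτ1⟩ := hsol.eq_of_pos hh hαI hpos h1 ht
    obtain ⟨hx2, hτ2⟩ := hsol.eq_of_pos hh hαI hpos h2 ht
    exact ⟨hx1.trans hx2.symm, hτ1.trans hτ2.symm⟩
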